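/- Suppose f is C¹ and let t_1 ≥ 0 be such that 2ρ_{t_1} + η_{t_1} < 0. Then there exist t_2 > t_1 and x > 0 such that the model-V cost of the round trip (buy x at time t_1, sell x at time t_2) is negative: λ(t_1)·G(x/λ(t_1)) + λ(t_2)·[G(x·(a−1)/λ(t_2)) − G(x·a/λ(t_2))] < 0, where a = exp(−∫_{t_1}^{t_2} ρ_s ds). -/

import Mathlib

open MeasureTheory Filter

/-- `F(y) = ∫_0^y f(x) dx`. -/
noncomputable def Fint (f : ℝ → ℝ) (y : ℝ) : ℝ := ∫ x in (0:ℝ)..y, f x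

/-- `F̃(x) = ∫_0^x y f(y) dy`. -/
noncomputable def Ftil (f : ℝ → ℝ) (x : ℝ) : ℝ := ∫ y in (0:ℝ)..x, y * f y

/-- `G = F̃ ∘ F⁻¹`, where `Finv` plays the role of `F⁻¹`. -/
noncomputable def Gfun (f Finv : ℝ → ℝ) (x : ℝ) : ℝ := Ftil f (Finv x)

theorem hasDerivAt_Fint {f : ℝ → ℝ} (hf : Continuous f) (y : ℝ) :
    HasDerivAt (Fint f) (f y) y :=
  hf.integral_hasStrictDerivAt 0 y |>.hasDerivAt

theorem hasDerivAt_Ftil {f : ℝ → ℝ} (hf : Continuous f) (y : ℝ) :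
    HasDerivAt (Ftil f) (y * f y) y :=
  (continuous_id.mul hf).integral_hasStrictDerivAt 0 y |>.hasDerivAt

theorem strictMono_Fint {f : ℝ → ℝ} (hf : Continuous f) (hfpos : ∀ x, 0 < f x) :
    StrictMono (Fint f) :=
  strictMono_of_deriv_pos fun x => by
    rw [(hasDerivAt_Fint hf x).deriv]
    exact hfpos x

theorem hasDerivAt_Finv {f Finv : ℝ → ℝ} (hf : Continuous f) (hfpos : ∀ x, 0 < f x)
    (hleft : ∀ y, Fint f (Finv y) = y) (hright : ∀ y, Finv (Fint f y) = y) (y : ℝ) :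
    HasDerivAt Finv (f (Finv y))⁻¹ y := by
  have hmono : Monotone Finv := fun a b hab => by
    rw [← (strictMono_Fint hf hfpos).le_iff_le, hleft, hleft]
    exact hab
  have hcont : Continuous Finv :=
    hmono.continuous_of_surjective fun y => ⟨Fint f y, hright y⟩
  exact (hasDerivAt_Fint hf (Finv y)).of_local_left_inverse hcont.continuousAt
    (hfpos _).ne' (Eventually.of_forall hleft)

theorem hasDerivAt_Gfun {f Finv : ℝ → ℝ} (hf : Continuous f) (hfpos : ∀ x, 0 < f x)
    (hleft : ∀ y, Fint f (Finv y) = y) (hright : ∀ y, Finv (Fint f y) = y) (y : ℝ) :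
    HasDerivAt (Gfun f Finv) (Finv y) y := by
  have h := (hasDerivAt_Ftil hf (Finv y)).comp y (hasDerivAt_Finv hf hfpos hleft hright y)
  rwa [mul_assoc, mul_inv_cancel₀ (hfpos _).ne', mul_one] at h

theorem Finv_zero {f Finv : ℝ → ℝ} (hright : ∀ y, Finv (Fint f y) = y) : Finv 0 = 0 := by
  simpa [Fint] using hright 0

theorem Gfun_zero {f Finv : ℝ → ℝ} (hright : ∀ y, Finv (Fint f y) = y) :
    Gfun f Finv 0 = 0 := by
  simp [Gfun, Finv_zero hright, Ftil]

theorem tendsto_Gfun_div_sq {f Finv : ℝ → ℝ} (hf : Continuous f) (hfpos : ∀ x, 0 < f x)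
    (hleft : ∀ y, Fint f (Finv y) = y) (hright : ∀ y, Finv (Fint f y) = y) :
    Tendsto (fun z => Gfun f Finv z / z ^ 2) (nhdsWithin 0 {0}ᶜ) (nhds ((f 0)⁻¹ / 2)) := by
  have hG := hasDerivAt_Gfun hf hfpos hleft hright
  have hinv := hasDerivAt_Finv hf hfpos hleft hright 0
  rw [hasDerivAt_iff_tendsto_slope, Finv_zero hright] at hinv
  refine HasDerivAt.lhopital_zero_nhdsNE (f' := Finv) (g' := fun z => 2 * z)
    (Eventually.of_forall hG)
    (Eventually.of_forall fun z => by simpa using hasDerivAt_pow 2 z) ?_ ?_ ?_ ?_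
  · filter_upwards [self_mem_nhdsWithin] with z hz
    exact mul_ne_zero two_ne_zero hz
  · have h := (hG 0).continuousAt.tendsto
    rw [Gfun_zero hright] at h
    exact h.mono_left nhdsWithin_le_nhds
  · have h : Tendsto (fun z : ℝ => z ^ 2) (nhds 0) (nhds (0 ^ 2)) :=
      (continuous_pow 2).tendsto 0
    rw [zero_pow two_ne_zero] at h
    exact h.mono_left nhdsWithin_le_nhds
  · refine (hinv.div_const 2).congr fun z => ?_
    rw [slope_def_field, Finv_zero hright, sub_zero, sub_zero, div_div, mul_comm]

theorem tendsto_Gfun_mul_div_sq {f Finv : ℝ → ℝ} (hf : Continuous f) (hfpos : ∀ x, 0 < f x)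
    (hleft : ∀ y, Fint f (Finv y) = y) (hright : ∀ y, Finv (Fint f y) = y) (k : ℝ) :
    Tendsto (fun x => Gfun f Finv (x * k) / x ^ 2) (nhdsWithin 0 (Set.Ioi 0))
      (nhds ((f 0)⁻¹ / 2 * k ^ 2)) := by
  rcases eq_or_ne k 0 with rfl | hk
  · simp [Gfun_zero hright]
  have hlim : Tendsto (fun x : ℝ => x * k) (nhdsWithin 0 (Set.Ioi 0)) (nhdsWithin 0 {0}ᶜ) := by
    refine tendsto_nhdsWithin_iff.2 ⟨?_, ?_⟩
    · have h : Tendsto (fun x : ℝ => x * k) (nhds 0) (nhds (0 * k)) :=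
        (continuous_mul_const k).tendsto 0
      rw [zero_mul] at h
      exact h.mono_left nhdsWithin_le_nhds
    · filter_upwards [self_mem_nhdsWithin] with x hx
      exact mul_ne_zero (ne_of_gt hx) hk
  refine (((tendsto_Gfun_div_sq hf hfpos hleft hright).comp hlim).mul_const (k ^ 2)).congr
    fun x => ?_
  simp only [Function.comp_apply]
  rw [mul_pow, ← div_div, div_mul_cancel₀ _ (pow_ne_zero 2 hk)]

/-- A function vanishing at `a` with negative derivative there is negative just after `a`. -/
theorem eventually_neg_of_hasDerivAt {g : ℝ → ℝ} {g' a : ℝ} (hg : HasDerivAt g g' a)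
    (ha : g a = 0) (hg' : g' < 0) : ∀ᶠ t in nhdsWithin a (Set.Ioi a), g t < 0 := by
  have h := (hasDerivAt_iff_tendsto_slope.1 hg).mono_left
    (nhdsWithin_mono a fun t (ht : a < t) => ne_of_gt ht)
  filter_upwards [h.eventually_lt_const hg', self_mem_nhdsWithin] with t ht hat
  rw [slope_def_field, ha, sub_zero] at ht
  exact (div_neg_iff.1 ht).elim (fun h => absurd h.2 (not_lt.2 (sub_pos.2 hat).le)) And.left

/-- The leading coefficient of the round-trip cost is negative for some later time. -/
theorem exists_time_neg {ρ lam : ℝ → ℝ} (hρ : Continuous ρ) {t1 : ℝ}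
    (hlam : DifferentiableAt ℝ lam t1) (hpos : 0 < lam t1)
    (hcond : 2 * ρ t1 + deriv lam t1 / lam t1 < 0) :
    ∃ t2, t1 < t2 ∧ lam t2 + lam t1 * (1 - 2 * Real.exp (-∫ s in t1..t2, ρ s)) < 0 := by
  have hprim : HasDerivAt (fun t => ∫ s in t1..t, ρ s) (ρ t1) t1 :=
    hρ.integral_hasStrictDerivAt t1 t1 |>.hasDerivAt
  have hder := hlam.hasDerivAt.add
    (((hprim.neg.exp.const_mul 2).const_sub 1).const_mul (lam t1))
  have hneg := eventually_neg_of_hasDerivAt hder (by simp; ring) (by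
    have h := mul_neg_of_pos_of_neg hpos hcond
    rw [mul_add, mul_div_cancel₀ _ hpos.ne'] at h
    simp
    linarith)
  obtain ⟨t, hlt, ht⟩ := (hneg.and self_mem_nhdsWithin).exists
  exact ⟨t, ht, hlt⟩

theorem stmt19 (f ρ lam Finv : ℝ → ℝ)
    (hf : ContDiff ℝ 1 f) (hfpos : ∀ x, 0 < f x)
    (hFbot : Tendsto (Fint f) atBot atBot) (hFtop : Tendsto (Fint f) atTop atTop)
    (hFinv1 : ∀ y, Fint f (Finv y) = y) (hFinv2 : ∀ y, Finv (Fint f y) = y)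
    (hρ : ContDiff ℝ 1 ρ) (hρpos : ∀ s, 0 ≤ s → 0 < ρ s)
    (hlam : ContDiff ℝ 2 lam) (hlampos : ∀ s, 0 ≤ s → 0 < lam s)
    (t1 : ℝ) (ht1 : 0 ≤ t1)
    (hcond : 2 * ρ t1 + deriv lam t1 / lam t1 < 0) :
    ∃ t2, t1 < t2 ∧ ∃ x : ℝ, 0 < x ∧
      lam t1 * Gfun f Finv (x / lam t1) +
        lam t2 * (Gfun f Finv (x * (Real.exp (-∫ s in t1..t2, ρ s) - 1) / lam t2) -
          Gfun f Finv (x * Real.exp (-∫ s in t1..t2, ρ s) / lam t2)) < 0 := by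
  obtain ⟨t2, ht, hneg⟩ := exists_time_neg hρ.continuous
    (hlam.differentiable two_ne_zero t1) (hlampos t1 ht1) hcond
  refine ⟨t2, ht, ?_⟩
  have h1 := hlampos t1 ht1
  have h2 := hlampos t2 (ht1.trans ht.le)
  set a := Real.exp (-∫ s in t1..t2, ρ s)
  have hG := tendsto_Gfun_mul_div_sq hf.continuous hfpos hFinv1 hFinv2
  have hlim := ((hG (1 / lam t1)).const_mul (lam t1)).add
    (((hG ((a - 1) / lam t2)).sub (hG (a / lam t2))).const_mul (lam t2))
  have hlimit : lam t1 * ((f 0)⁻¹ / 2 * (1 / lam t1) ^ 2) +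
      lam t2 * ((f 0)⁻¹ / 2 * ((a - 1) / lam t2) ^ 2 - (f 0)⁻¹ / 2 * (a / lam t2) ^ 2) < 0 := by
    have hf0 := hfpos 0
    have heq : lam t1 * ((f 0)⁻¹ / 2 * (1 / lam t1) ^ 2) +
        lam t2 * ((f 0)⁻¹ / 2 * ((a - 1) / lam t2) ^ 2 - (f 0)⁻¹ / 2 * (a / lam t2) ^ 2) =
        (lam t2 + lam t1 * (1 - 2 * a)) / (2 * f 0 * lam t1 * lam t2) := by
      field_simp
      ring
    rw [heq]
    exact div_neg_of_neg_of_pos hneg (by positivity)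
  obtain ⟨x, hxneg, hx⟩ := ((hlim.eventually_lt_const hlimit).and self_mem_nhdsWithin).exists
  have hx0 : 0 < x := hx
  refine ⟨x, hx0, ?_⟩
  simp only [← mul_div_assoc, mul_one, ← sub_div, ← add_div] at hxneg
  exact (div_neg_iff.1 hxneg).elim (fun h => absurd h.2 (not_lt.2 (sq_nonneg x))) And.left
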